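/- arXiv:2512.10759 — 3 statements merged into one kernel-verified Lean document; each statement's English description precedes it below -/
import Mathlib

section
/- Let U be a process on a complete metric space X possessing a pullback attractor A = {A(t)}, and assume U is forward asymptotically compact. Then the following are equivalent: (i) ω_f(B,t₀) ⊆ ω₀(A) for every bounded set B and every t₀ ∈ ℝ; (ii) ω_f(B,t₀) ⊆ ω(A) for every bounded set B and every t₀ ∈ ℝ, and dist_H(A(t), ω(A)) → 0 as t → +∞. -/
open Filter Topology Set Metric Bornology ENNReal

variable {X : Type*} [MetricSpace X]

/-- Hausdorff semidistance `dist(A,B) = sup_{a ∈ A} inf_{b ∈ B} d(a,b)`,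
valued in `ℝ≥0∞`. -/
noncomputable def esemidist (A B : Set X) : ℝ≥0∞ :=
  ⨆ a : A, EMetric.infEdist (a : X) B

/-- Hausdorff distance `dist_H(A,B) = max{dist(A,B), dist(B,A)}`. -/
noncomputable def ehdist (A B : Set X) : ℝ≥0∞ :=
  max (esemidist A B) (esemidist B A)

/-- A (single-valued) process on `X`. -/
def IsProcess (U : ℝ → ℝ → X → X) : Prop :=
  (∀ (s : ℝ) (x : X), U s s x = x) ∧
  (∀ (t τ s : ℝ) (x : X), s ≤ τ → τ ≤ t → U t s x = U t τ (U τ s x)) ∧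
  ContinuousOn (fun p : ℝ × ℝ × X => U p.1 p.2.1 p.2.2) {p : ℝ × ℝ × X | p.2.1 ≤ p.1}

/-- The process `U` is forward asymptotically compact. -/
def FwdAsympCompact (U : ℝ → ℝ → X → X) : Prop :=
  ∀ (t₀ : ℝ) (B : Set X), IsBounded B →
    ∀ (t : ℕ → ℝ) (y : ℕ → X), Tendsto t atTop atTop →
      (∀ n, t₀ ≤ t n ∧ y n ∈ U (t n) t₀ '' B) →
      ∃ (φ : ℕ → ℕ) (z : X), StrictMono φ ∧ Tendsto (y ∘ φ) atTop (𝓝 z)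

/-- Forward ω-limit set `ω_f(B,t₀)` of a set `B` for initial time `t₀`. -/
def omegaF (U : ℝ → ℝ → X → X) (B : Set X) (t₀ : ℝ) : Set X :=
  {y | ∃ (t : ℕ → ℝ) (yn : ℕ → X), Tendsto t atTop atTop ∧
        (∀ n, t₀ ≤ t n ∧ yn n ∈ U (t n) t₀ '' B) ∧ Tendsto yn atTop (𝓝 y)}

/-- ω-limit set `ω(K)` of a family of sets `K = {K(t)}`. -/
def omegaFam (K : ℝ → Set X) : Set X :=
  {y | ∃ (t : ℕ → ℝ) (yn : ℕ → X), Tendsto t atTop atTop ∧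
        (∀ n, yn n ∈ K (t n)) ∧ Tendsto yn atTop (𝓝 y)}

/-- The set `ω₀(K) = Liminf_{t → +∞} K(t)`. -/
def omega0Fam (K : ℝ → Set X) : Set X :=
  {y | Tendsto (fun t => EMetric.infEdist y (K t)) atTop (𝓝 0)}

/-- The family `C = {C(t)}` pullback attracts every bounded set. -/
def PullbackAttracts (U : ℝ → ℝ → X → X) (C : ℝ → Set X) : Prop :=
  ∀ (t : ℝ) (B : Set X), IsBounded B →
    Tendsto (fun t₀ => esemidist (U t t₀ '' B) (C t)) atBot (𝓝 0)

/-- A pullback attractor: a family of nonempty compact invariant sets which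
pullback attracts every bounded set and is minimal among closed pullback
attracting families. -/
def IsPullbackAttractor (U : ℝ → ℝ → X → X) (A : ℝ → Set X) : Prop :=
  (∀ t, (A t).Nonempty) ∧ (∀ t, IsCompact (A t)) ∧
  (∀ t s : ℝ, s ≤ t → A t = U t s '' A s) ∧
  PullbackAttracts U A ∧
  (∀ C : ℝ → Set X, (∀ t, IsClosed (C t)) → PullbackAttracts U C → ∀ t, A t ⊆ C t)

/-- The family `A = {A(t)}` forward attracts every bounded set. -/
def ForwardAttracts (U : ℝ → ℝ → X → X) (A : ℝ → Set X) : Prop :=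
  ∀ (t₀ : ℝ) (B : Set X), IsBounded B →
    Tendsto (fun t => esemidist (U t t₀ '' B) (A t)) atTop (𝓝 0)

/-- A forward attractor: a family of nonempty compact invariant sets which
forward attracts every bounded set. -/
def IsForwardAttractor (U : ℝ → ℝ → X → X) (A : ℝ → Set X) : Prop :=
  (∀ t, (A t).Nonempty) ∧ (∀ t, IsCompact (A t)) ∧
  (∀ t s : ℝ, s ≤ t → A t = U t s '' A s) ∧
  ForwardAttracts U A

theorem tendsto_esemidist_of_seq {F G : ℝ → Set X}
    (h : ∀ (t : ℕ → ℝ) (y : ℕ → X), Tendsto t atTop atTop → (∀ n, y n ∈ F (t n)) →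
      ∃ φ : ℕ → ℕ, StrictMono φ ∧
        Tendsto (fun n => infEDist (y (φ n)) (G (t (φ n)))) atTop (𝓝 0)) :
    Tendsto (fun t => esemidist (F t) (G t)) atTop (𝓝 0) := by
  rw [ENNReal.tendsto_nhds_zero]
  by_contra! hne
  obtain ⟨ε, hε, hf⟩ := hne
  obtain ⟨t, ht, hlt⟩ := exists_seq_forall_of_frequently hf
  have hy : ∀ n, ∃ y ∈ F (t n), ε < infEDist y (G (t n)) := by
    intro n
    have hlt' : ε < ⨆ a : F (t n), infEDist (a : X) (G (t n)) := hlt n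
    obtain ⟨⟨y, hy⟩, hlt⟩ := lt_iSup_iff.mp hlt'
    exact ⟨y, hy, hlt⟩
  choose y hyF hyG using hy
  obtain ⟨φ, -, hφ⟩ := h t y ht hyF
  obtain ⟨n, hn⟩ := ((ENNReal.tendsto_nhds_zero.mp hφ) ε hε).exists
  exact (hyG (φ n)).not_ge hn

theorem infEDist_le_esemidist {A B : Set X} {a : X} (ha : a ∈ A) :
    infEDist a B ≤ esemidist A B :=
  le_iSup (fun a : A => infEDist (a : X) B) ⟨a, ha⟩

theorem omega0Fam_subset_omegaFam {K : ℝ → Set X} (hK : ∀ t, (K t).Nonempty) :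
    omega0Fam K ⊆ omegaFam K := by
  intro y hy
  have hex : ∀ n : ℕ, ∃ z ∈ K n, edist y z < infEDist y (K n) + ((n : ℝ≥0∞) + 1)⁻¹ := by
    intro n
    apply infEDist_lt_iff.mp
    exact ENNReal.lt_add_right (infEDist_ne_top (hK n))
      (ENNReal.inv_ne_zero.mpr (by finiteness))
  choose z hzK hz using hex
  refine ⟨fun n => n, z, tendsto_natCast_atTop_atTop, hzK, ?_⟩
  have hinv : Tendsto (fun n : ℕ => ((n : ℝ≥0∞) + 1)⁻¹) atTop (𝓝 0) := by
    simpa using (tendsto_add_atTop_iff_nat 1).mpr ENNReal.tendsto_inv_nat_nhds_zero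
  have hlim := (Tendsto.comp hy tendsto_natCast_atTop_atTop).add hinv
  rw [add_zero] at hlim
  rw [tendsto_iff_edist_tendsto_0]
  refine tendsto_of_tendsto_of_tendsto_of_le_of_le tendsto_const_nhds hlim
    (fun _ => zero_le) fun n => ?_
  rw [edist_comm]
  exact (hz n).le

theorem exists_mem_edist_lt_of_mem_omegaFam {K : ℝ → Set X} {y : X} (hy : y ∈ omegaFam K)
    (T : ℝ) {ε : ℝ≥0∞} (hε : 0 < ε) : ∃ s ≥ T, ∃ z ∈ K s, edist z y < ε := by
  obtain ⟨t, u, ht, hu, hlim⟩ := hy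
  obtain ⟨n, hn, hd⟩ := ((ht.eventually_ge_atTop T).and
    ((tendsto_iff_edist_tendsto_0.mp hlim).eventually_lt_const hε)).exists
  exact ⟨t n, hn, u n, hu n, hd⟩

theorem omegaFam_subset_omegaF {U : ℝ → ℝ → X → X} {A : ℝ → Set X}
    (hinv : ∀ t s : ℝ, s ≤ t → A t = U t s '' A s) (t₀ : ℝ) :
    omegaFam A ⊆ omegaF U (A t₀) t₀ := by
  rintro y ⟨t, u, ht, hu, hlim⟩
  obtain ⟨N, hN⟩ := eventually_atTop.mp (ht.eventually_ge_atTop t₀)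
  refine ⟨fun n => t (n + N), fun n => u (n + N), (tendsto_add_atTop_iff_nat N).mpr ht,
    fun n => ⟨hN _ (Nat.le_add_left _ _), ?_⟩, (tendsto_add_atTop_iff_nat N).mpr hlim⟩
  rw [← hinv _ _ (hN _ (Nat.le_add_left _ _))]
  exact hu _

theorem FwdAsympCompact.exists_tendsto_subseq {U : ℝ → ℝ → X → X} {A : ℝ → Set X}
    (hFC : FwdAsympCompact U) (hinv : ∀ t s : ℝ, s ≤ t → A t = U t s '' A s)
    (hbdd : ∀ t, IsBounded (A t)) {t : ℕ → ℝ} {y : ℕ → X} (ht : Tendsto t atTop atTop)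
    (hy : ∀ n, y n ∈ A (t n)) :
    ∃ φ : ℕ → ℕ, StrictMono φ ∧ ∃ z ∈ omegaFam A, Tendsto (y ∘ φ) atTop (𝓝 z) := by
  obtain ⟨N, hN⟩ := eventually_atTop.mp (ht.eventually_ge_atTop 0)
  obtain ⟨φ, z, hφ, hz⟩ := hFC 0 (A 0) (hbdd 0) (fun n => t (n + N)) (fun n => y (n + N))
    ((tendsto_add_atTop_iff_nat N).mpr ht) fun n => ⟨hN _ (Nat.le_add_left _ _), by
      rw [← hinv _ _ (hN _ (Nat.le_add_left _ _))]
      exact hy _⟩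
  have hmono : StrictMono fun n => φ n + N := fun _ _ h => Nat.add_lt_add_right (hφ h) N
  exact ⟨fun n => φ n + N, hmono, z,
    ⟨fun n => t (φ n + N), fun n => y (φ n + N), ht.comp hmono.tendsto_atTop,
      fun n => hy _, hz⟩, hz⟩

theorem tendsto_esemidist_omegaFam {U : ℝ → ℝ → X → X} {A : ℝ → Set X}
    (hFC : FwdAsympCompact U) (hinv : ∀ t s : ℝ, s ≤ t → A t = U t s '' A s)
    (hbdd : ∀ t, IsBounded (A t)) :
    Tendsto (fun t => esemidist (A t) (omegaFam A)) atTop (𝓝 0) := by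
  refine tendsto_esemidist_of_seq (G := fun _ => omegaFam A) fun t y ht hy => ?_
  obtain ⟨φ, hφ, z, hz, hlim⟩ := hFC.exists_tendsto_subseq hinv hbdd ht hy
  exact ⟨φ, hφ, tendsto_of_tendsto_of_tendsto_of_le_of_le tendsto_const_nhds
    (tendsto_iff_edist_tendsto_0.mp hlim) (fun _ => zero_le)
    fun _ => infEDist_le_edist_of_mem hz⟩

theorem tendsto_esemidist_omegaFam_left {U : ℝ → ℝ → X → X} {A : ℝ → Set X}
    (hFC : FwdAsympCompact U) (hinv : ∀ t s : ℝ, s ≤ t → A t = U t s '' A s)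
    (hbdd : ∀ t, IsBounded (A t)) (hsub : omegaFam A ⊆ omega0Fam A) :
    Tendsto (fun t => esemidist (omegaFam A) (A t)) atTop (𝓝 0) := by
  refine tendsto_esemidist_of_seq (F := fun _ => omegaFam A) fun t y ht hy => ?_
  have hpos : ∀ n : ℕ, 0 < ((n : ℝ≥0∞))⁻¹ := fun n =>
    ENNReal.inv_pos.mpr (ENNReal.natCast_ne_top n)
  choose s hs u hu hd using fun n : ℕ =>
    exists_mem_edist_lt_of_mem_omegaFam (hy n) n (hpos n)
  obtain ⟨φ, hφ, z, hz, hlim⟩ := hFC.exists_tendsto_subseq hinv hbdd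
    (tendsto_atTop_mono hs tendsto_natCast_atTop_atTop) hu
  refine ⟨φ, hφ, ?_⟩
  have hz₀ : Tendsto (fun t => infEDist z (A t)) atTop (𝓝 0) := hsub hz
  have h₀ : Tendsto (fun n => infEDist z (A (t (φ n)))) atTop (𝓝 0) :=
    hz₀.comp (ht.comp hφ.tendsto_atTop)
  have h₁ : Tendsto (fun n => edist (u (φ n)) z) atTop (𝓝 0) :=
    tendsto_iff_edist_tendsto_0.mp hlim
  have h₂ := ENNReal.tendsto_inv_nat_nhds_zero.comp hφ.tendsto_atTop
  have h₃ := h₀.add (h₂.add h₁)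
  simp only [add_zero] at h₃
  refine tendsto_of_tendsto_of_tendsto_of_le_of_le tendsto_const_nhds h₃
    (fun _ => zero_le) fun n => ?_
  refine infEDist_le_infEDist_add_edist.trans (add_le_add_right ?_ _)
  refine (edist_triangle _ (u (φ n)) _).trans (add_le_add_left ?_ _)
  rw [edist_comm]
  exact (hd _).le

/-- For a forward asymptotically compact process `U` with pullback
attractor `A`: `ω_f(B,t₀) ⊆ ω₀(A)` for all bounded `B` and all `t₀` iff
`ω_f(B,t₀) ⊆ ω(A)` for all bounded `B` and all `t₀` and
`dist_H(A(t), ω(A)) → 0` as `t → +∞`. -/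
theorem omega0_condition_iff [CompleteSpace X]
    (U : ℝ → ℝ → X → X) (hU : IsProcess U)
    (A : ℝ → Set X) (hA : IsPullbackAttractor U A)
    (hFC : FwdAsympCompact U) :
    (∀ B : Set X, IsBounded B → ∀ t₀ : ℝ, omegaF U B t₀ ⊆ omega0Fam A) ↔
      ((∀ B : Set X, IsBounded B → ∀ t₀ : ℝ, omegaF U B t₀ ⊆ omegaFam A) ∧
        Tendsto (fun t => ehdist (A t) (omegaFam A)) atTop (𝓝 0)) := by
  obtain ⟨hne, hcpt, hinv, -, -⟩ := hA
  have hbdd : ∀ t, IsBounded (A t) := fun t => (hcpt t).isBounded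
  constructor
  · intro h
    refine ⟨fun B hB t₀ => (h B hB t₀).trans (omega0Fam_subset_omegaFam hne), ?_⟩
    have hsub := (omegaFam_subset_omegaF hinv 0).trans (h (A 0) (hbdd 0) 0)
    simpa [ehdist] using (tendsto_esemidist_omegaFam hFC hinv hbdd).max
      (tendsto_esemidist_omegaFam_left hFC hinv hbdd hsub)
  · rintro ⟨h, hlim⟩ B hB t₀ y hy
    exact tendsto_of_tendsto_of_tendsto_of_le_of_le tendsto_const_nhds hlim
      (fun _ => zero_le)
      fun t => (infEDist_le_esemidist (h B hB t₀ hy)).trans (le_max_right _ _)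
end

section
/- Let U be a process on a complete metric space X possessing a pullback attractor A = {A(t)}, and assume U is forward asymptotically compact. Then the condition 'ω_f(B,t₀) ⊆ ω₀(A) for every bounded set B and every t₀ ∈ ℝ' holds if and only if dist(A_min, A(t)) → 0 as t → +∞. -/
open Filter Topology Set Metric Bornology ENNReal

variable {X : Type*} [MetricSpace X]

/-- The minimal forward attracting set
`A_min = closure (⋃_{B bounded} ⋃_{t₀ ∈ ℝ} ω_f(B,t₀))`. -/
def Amin (U : ℝ → ℝ → X → X) : Set X :=
  closure (⋃ (B : Set X) (_ : IsBounded B) (t₀ : ℝ), omegaF U B t₀)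

/-- The semidistance from `S` to `T` is at most `r` iff every point of `S` is within `r` of `T`. -/
theorem esemidist_le_iff {S T : Set X} {r : ℝ≥0∞} :
    esemidist S T ≤ r ↔ ∀ a ∈ S, infEDist a T ≤ r := by
  refine iSup_le_iff.trans ⟨fun h a ha => h ⟨a, ha⟩, fun h a => h a a.2⟩

/-- If `K` comes arbitrarily close to each `y n` at arbitrarily late times, then some `z n ∈ K (t n)`
with `t n → ∞` satisfy `d(y n, z n) → 0`. -/
theorem exists_seq_of_infEDist_lt {K : ℝ → Set X} {y : ℕ → X} {t₀ : ℝ}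
    (h : ∀ n, ∀ ε > 0, ∃ᶠ t in atTop, infEDist (y n) (K t) < ε) :
    ∃ (t : ℕ → ℝ) (z : ℕ → X), Tendsto t atTop atTop ∧ (∀ n, t₀ ≤ t n ∧ z n ∈ K (t n)) ∧
      Tendsto (fun n => edist (y n) (z n)) atTop (𝓝 0) := by
  have key : ∀ n : ℕ, ∃ (t : ℝ) (z : X), (n : ℝ) ≤ t ∧ t₀ ≤ t ∧ z ∈ K t ∧
      edist (y n) z < ((n : ℝ≥0∞))⁻¹ := by
    intro n
    obtain ⟨t, ht, hn, h₀⟩ := ((h n (n : ℝ≥0∞)⁻¹ (by simp)).and_eventually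
      ((eventually_ge_atTop (n : ℝ)).and (eventually_ge_atTop t₀))).exists
    obtain ⟨z, hz, hd⟩ := infEDist_lt_iff.1 ht
    exact ⟨t, z, hn, h₀, hz, hd⟩
  choose t z hn h₀ hz hd using key
  exact ⟨t, z, tendsto_atTop_mono hn tendsto_natCast_atTop_atTop, fun n => ⟨h₀ n, hz n⟩,
    tendsto_of_tendsto_of_tendsto_of_le_of_le tendsto_const_nhds
      ENNReal.tendsto_inv_nat_nhds_zero (fun _ => zero_le) fun n => (hd n).le⟩

/-- A point lies in `ω_f(B,t₀)` iff the images of `B` come arbitrarily close to it at arbitrarily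
late times. -/
theorem mem_omegaF_iff_frequently {U : ℝ → ℝ → X → X} {B : Set X} {t₀ : ℝ} {y : X} :
    y ∈ omegaF U B t₀ ↔ ∀ ε > 0, ∃ᶠ t in atTop, infEDist y (U t t₀ '' B) < ε := by
  constructor
  · rintro ⟨t, z, ht, hz, hlim⟩ ε hε
    have hd : ∀ᶠ n in atTop, edist (z n) y < ε :=
      (tendsto_iff_edist_tendsto_0.1 hlim).eventually (gt_mem_nhds hε)
    refine ht.frequently (hd.mono fun n hn => ?_).frequently
    exact infEDist_lt_iff.2 ⟨z n, (hz n).2, by rwa [edist_comm]⟩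
  · intro h
    obtain ⟨t, z, ht, hz, hlim⟩ :=
      exists_seq_of_infEDist_lt (K := fun t => U t t₀ '' B) (y := fun _ => y) (t₀ := t₀)
        fun _ => h
    exact ⟨t, z, ht, hz, tendsto_iff_edist_tendsto_0.2 (by simpa only [edist_comm] using hlim)⟩

/-- Forward ω-limit sets of bounded sets are compact. -/
theorem FwdAsympCompact.isCompact_omegaF {U : ℝ → ℝ → X → X} (hU : FwdAsympCompact U)
    {B : Set X} (hB : IsBounded B) (t₀ : ℝ) : IsCompact (omegaF U B t₀) := by
  refine IsSeqCompact.isCompact fun y hy => ?_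
  obtain ⟨t, z, ht, hz, hlim⟩ :=
    exists_seq_of_infEDist_lt (K := fun t => U t t₀ '' B) (t₀ := t₀)
      fun n => mem_omegaF_iff_frequently.1 (hy n)
  obtain ⟨φ, a, hφ, ha⟩ := hU t₀ B hB t z ht hz
  refine ⟨a, ⟨t ∘ φ, z ∘ φ, ht.comp hφ.tendsto_atTop, fun n => hz (φ n), ha⟩, φ, hφ, ?_⟩
  rw [tendsto_iff_edist_tendsto_0] at ha ⊢
  have hsum := (hlim.comp hφ.tendsto_atTop).add ha
  rw [add_zero] at hsum
  exact tendsto_of_tendsto_of_tendsto_of_le_of_le tendsto_const_nhds hsum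
    (fun _ => zero_le) fun n => edist_triangle _ _ _

/-- If every point of a compact set belongs to `ω₀(K)`, then the family `K` attracts that compact
set uniformly. -/
theorem IsCompact.tendsto_esemidist {S : Set X} (hS : IsCompact S) {K : ℝ → Set X}
    (h : S ⊆ omega0Fam K) : Tendsto (fun t => esemidist S (K t)) atTop (𝓝 0) := by
  refine ENNReal.tendsto_nhds_zero.2 fun ε hε => ?_
  have hε2 : 0 < ε / 2 := ENNReal.half_pos hε.ne'
  obtain ⟨F, hFS, hF⟩ := hS.elim_nhds_subcover (fun x => eball x (ε / 2))
    fun x _ => eball_mem_nhds x hε2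
  have hev : ∀ᶠ t in atTop, ∀ x ∈ F, infEDist x (K t) ≤ ε / 2 :=
    (Filter.eventually_all_finset F).2 fun x hx =>
      ENNReal.tendsto_nhds_zero.1 (h (hFS x hx)) _ hε2
  filter_upwards [hev] with t ht
  refine esemidist_le_iff.2 fun a ha => ?_
  obtain ⟨x, hx, hax⟩ := mem_iUnion₂.1 (hF ha)
  calc infEDist a (K t) ≤ infEDist x (K t) + edist a x := infEDist_le_infEDist_add_edist
    _ ≤ ε / 2 + ε / 2 := add_le_add (ht x hx) (le_of_lt hax)
    _ = ε := ENNReal.add_halves ε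

/-- For an invariant family, `ω₀(A)` is contained in the forward ω-limit set of each section. -/
theorem omega0Fam_subset_omegaF {U : ℝ → ℝ → X → X} {A : ℝ → Set X}
    (hA : ∀ t s : ℝ, s ≤ t → A t = U t s '' A s) (s : ℝ) :
    omega0Fam A ⊆ omegaF U (A s) s := by
  intro y hy
  refine mem_omegaF_iff_frequently.2 fun ε hε => Eventually.frequently ?_
  have hlt : ∀ᶠ t in atTop, infEDist y (A t) < ε :=
    Tendsto.eventually hy (gt_mem_nhds hε)
  filter_upwards [hlt, eventually_ge_atTop s] with t ht hst
  rwa [← hA t s hst]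

/-- For a forward asymptotically compact process `U` with pullback
attractor `A`: `ω_f(B,t₀) ⊆ ω₀(A)` for all bounded `B` and all `t₀` iff
`dist(A_min, A(t)) → 0` as `t → +∞`. -/
theorem omega0_condition_iff_Amin [CompleteSpace X]
    (U : ℝ → ℝ → X → X) (hU : IsProcess U)
    (A : ℝ → Set X) (hA : IsPullbackAttractor U A)
    (hFC : FwdAsympCompact U) :
    (∀ B : Set X, IsBounded B → ∀ t₀ : ℝ, omegaF U B t₀ ⊆ omega0Fam A) ↔
      Tendsto (fun t => esemidist (Amin U) (A t)) atTop (𝓝 0) := by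
  obtain ⟨-, hcomp, hinv, -, -⟩ := hA
  constructor
  · intro h
    have hbdd : IsBounded (A 0) := (hcomp 0).isBounded
    have hK : IsCompact (omegaF U (A 0) 0) := hFC.isCompact_omegaF hbdd 0
    have hsub : Amin U ⊆ omegaF U (A 0) 0 :=
      closure_minimal (iUnion₂_subset fun B hB => iUnion_subset fun t₀ =>
        (h B hB t₀).trans (omega0Fam_subset_omegaF hinv 0)) hK.isClosed
    exact (hK.of_isClosed_subset isClosed_closure hsub).tendsto_esemidist
      (hsub.trans (h _ hbdd 0))
  · intro h B hB t₀ y hy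
    have hmem : y ∈ Amin U :=
      subset_closure (mem_iUnion₂.2 ⟨B, hB, mem_iUnion.2 ⟨t₀, hy⟩⟩)
    exact tendsto_of_tendsto_of_tendsto_of_le_of_le tendsto_const_nhds h
      (fun _ => zero_le) fun t => esemidist_le_iff.1 le_rfl y hmem
end

section
/- Let U be a process on a complete metric space X possessing a pullback attractor A = {A(t)}, and let S be a semigroup on X possessing a global attractor A_∞. Assume U is asymptotically autonomous with limit semigroup S, forward asymptotically compact, and that dist_H(A(t), A_∞) → 0 as t → +∞. Then A is a forward attractor. -/
open Filter Topology Set Metric Bornology ENNReal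

variable {X : Type*} [MetricSpace X]

/-- A continuous semigroup on `X` (defined for nonnegative times). -/
def IsSemigroupFlow (S : ℝ → X → X) : Prop :=
  (∀ x : X, S 0 x = x) ∧
  (∀ (t s : ℝ) (x : X), 0 ≤ t → 0 ≤ s → S (t + s) x = S t (S s x)) ∧
  ContinuousOn (fun p : ℝ × X => S p.1 p.2) {p : ℝ × X | 0 ≤ p.1}

/-- A global attractor for a semigroup `S`: a compact invariant set attracting
every bounded set. -/
def IsGlobalAttractor (S : ℝ → X → X) (Ainf : Set X) : Prop :=
  IsCompact Ainf ∧ (∀ t : ℝ, 0 ≤ t → S t '' Ainf = Ainf) ∧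
  ∀ B : Set X, IsBounded B →
    Tendsto (fun t => esemidist (S t '' B) Ainf) atTop (𝓝 0)

/-- The process `U` is asymptotically autonomous with limit semigroup `S`:
for all sequences `τ_n → +∞` and `x_n → x₀` one has
`U(t + τ_n, τ_n, x_n) → S(t, x₀)` for every `t ≥ 0`. -/
def AsympAutonomous (U : ℝ → ℝ → X → X) (S : ℝ → X → X) : Prop :=
  ∀ (τ : ℕ → ℝ) (x : ℕ → X) (x₀ : X), Tendsto τ atTop atTop →
    Tendsto x atTop (𝓝 x₀) → ∀ t : ℝ, 0 ≤ t →
      Tendsto (fun n => U (t + τ n) (τ n) (x n)) atTop (𝓝 (S t x₀))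

theorem infEdist_le_esemidist {A : Set X} {a : X} (ha : a ∈ A) (B : Set X) :
    infEDist a B ≤ esemidist A B :=
  le_iSup (fun a : A => infEDist (a : X) B) ⟨a, ha⟩

/-- Forward ω-limit sets of a forward asymptotically compact process are bounded. -/
theorem isBounded_omegaF {U : ℝ → ℝ → X → X} (hFC : FwdAsympCompact U)
    {B : Set X} (hB : IsBounded B) (t₀ : ℝ) : IsBounded (omegaF U B t₀) := by
  rcases (omegaF U B t₀).eq_empty_or_nonempty with he | ⟨p, -⟩
  · simp [he]
  by_contra hunb
  have hfar (n : ℕ) : ∃ y ∈ omegaF U B t₀, (n : ℝ) + 1 < dist y p := by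
    by_contra! h
    exact hunb (isBounded_closedBall.subset (s := omegaF U B t₀) fun y hy =>
      mem_closedBall.2 (h y hy))
  have happrox (n : ℕ) : ∃ (t : ℝ) (v : X), (n : ℝ) ≤ t ∧ (t₀ ≤ t ∧ v ∈ U t t₀ '' B) ∧
      (n : ℝ) < dist v p := by
    obtain ⟨y, ⟨t, v, ht, hv, hvy⟩, hy⟩ := hfar n
    obtain ⟨k, hk, hvk⟩ := ((ht.eventually_ge_atTop (n : ℝ)).and
      (hvy.eventually (ball_mem_nhds y one_pos))).exists
    refine ⟨t k, v k, hk, hv k, ?_⟩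
    have := dist_triangle y (v k) p
    rw [dist_comm] at hvk
    linarith
  choose t v ht hv hfar' using happrox
  obtain ⟨φ, z, hφ, hz⟩ :=
    hFC t₀ B hB t v (tendsto_atTop_mono ht tendsto_natCast_atTop_atTop) hv
  have hinf : Tendsto (fun n => dist ((v ∘ φ) n) p) atTop atTop :=
    tendsto_atTop_mono (fun n => (hfar' (φ n)).le)
      (tendsto_natCast_atTop_atTop.comp hφ.tendsto_atTop)
  exact not_tendsto_nhds_of_tendsto_atTop hinf _ (hz.dist tendsto_const_nhds)

/-- Forward ω-limit sets are negatively invariant under the limit semigroup. -/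
theorem omegaF_subset_image {U : ℝ → ℝ → X → X} (hU : IsProcess U) {S : ℝ → X → X}
    (hAA : AsympAutonomous U S) (hFC : FwdAsympCompact U)
    {B : Set X} (hB : IsBounded B) (t₀ : ℝ) {r : ℝ} (hr : 0 ≤ r) :
    omegaF U B t₀ ⊆ S r '' omegaF U B t₀ := by
  rintro y ⟨t, v, ht, hv, hvy⟩
  obtain ⟨N, hN⟩ := eventually_atTop.1 (ht.eventually_ge_atTop (t₀ + r))
  choose htv x hxB hxv using hv
  have hshift := tendsto_add_atTop_nat N
  have hle (n : ℕ) : t₀ ≤ t (n + N) - r := by linarith [hN (n + N) (by omega)]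
  have hτ : Tendsto (fun n => t (n + N) - r) atTop atTop :=
    tendsto_atTop_add_const_right _ (-r) (ht.comp hshift)
  have hmem (n : ℕ) : t₀ ≤ t (n + N) - r ∧
      U (t (n + N) - r) t₀ (x (n + N)) ∈ U (t (n + N) - r) t₀ '' B :=
    ⟨hle n, mem_image_of_mem _ (hxB _)⟩
  obtain ⟨φ, w, hφ, hw⟩ := hFC t₀ B hB _ _ hτ hmem
  have hτφ := hτ.comp hφ.tendsto_atTop
  refine ⟨w, ⟨_, _, hτφ, fun n => hmem (φ n), hw⟩, ?_⟩
  refine tendsto_nhds_unique (hAA _ _ w hτφ hw r hr) ?_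
  refine ((hvy.comp hshift).comp hφ.tendsto_atTop).congr fun n => ?_
  simp only [Function.comp_apply]
  rw [← hU.2.1 _ _ _ _ (hle (φ n)) (by linarith), ← hxv]
  congr 1
  ring

/-- The global attractor of the limit semigroup contains all forward ω-limit sets. -/
theorem omegaF_subset_globalAttractor {U : ℝ → ℝ → X → X} (hU : IsProcess U)
    {S : ℝ → X → X} {Ainf : Set X} (hAinf : IsGlobalAttractor S Ainf)
    (hAA : AsympAutonomous U S) (hFC : FwdAsympCompact U)
    {B : Set X} (hB : IsBounded B) (t₀ : ℝ) : omegaF U B t₀ ⊆ Ainf := by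
  intro y hy
  rw [mem_iff_infEDist_zero_of_closed hAinf.1.isClosed]
  refine le_antisymm (ge_of_tendsto (hAinf.2.2 _ (isBounded_omegaF hFC hB t₀)) ?_) zero_le
  filter_upwards [eventually_ge_atTop (0 : ℝ)] with r hr
  exact infEdist_le_esemidist (omegaF_subset_image hU hAA hFC hB t₀ hr hy) _

/-- If `U` has a pullback attractor `A`, `S` has a global
attractor `A_∞`, `U` is asymptotically autonomous with limit semigroup `S` and
forward asymptotically compact, and `dist_H(A(t), A_∞) → 0` as `t → +∞`,
then `A` is a forward attractor. -/
theorem forwardAttractor_of_asympAutonomous [CompleteSpace X]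
    (U : ℝ → ℝ → X → X) (hU : IsProcess U)
    (A : ℝ → Set X) (hA : IsPullbackAttractor U A)
    (S : ℝ → X → X) (hS : IsSemigroupFlow S)
    (Ainf : Set X) (hAinf : IsGlobalAttractor S Ainf)
    (hAA : AsympAutonomous U S) (hFC : FwdAsympCompact U)
    (hH : Tendsto (fun t => ehdist (A t) Ainf) atTop (𝓝 0)) :
    IsForwardAttractor U A := by
  refine ⟨hA.1, hA.2.1, hA.2.2.1, fun t₀ B hB => ?_⟩
  rw [ENNReal.tendsto_nhds_zero]
  intro ε hε
  by_contra hne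
  obtain ⟨t, ht, hfar⟩ := exists_seq_forall_of_frequently
    ((not_eventually.1 hne).and_eventually (eventually_ge_atTop t₀))
  have hexists (n : ℕ) : ∃ v ∈ U (t n) t₀ '' B, ε < infEDist v (A (t n)) := by
    obtain ⟨⟨v, hv⟩, hlt⟩ := lt_iSup_iff.1 (not_le.1 (hfar n).1)
    exact ⟨v, hv, hlt⟩
  choose v hv hlt using hexists
  have hmem (n : ℕ) : t₀ ≤ t n ∧ v n ∈ U (t n) t₀ '' B := ⟨(hfar n).2, hv n⟩
  obtain ⟨φ, z, hφ, hz⟩ := hFC t₀ B hB t v ht hmem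
  have htφ := ht.comp hφ.tendsto_atTop
  have hzA : z ∈ Ainf := omegaF_subset_globalAttractor hU hAinf hAA hFC hB t₀
    ⟨t ∘ φ, v ∘ φ, htφ, fun n => hmem (φ n), hz⟩
  have hlim : Tendsto (fun n => ehdist (A (t (φ n))) Ainf + edist (v (φ n)) z) atTop (𝓝 0) := by
    simpa using (hH.comp htφ).add (tendsto_iff_edist_tendsto_0.1 hz)
  obtain ⟨n, hn⟩ := (hlim.eventually (gt_mem_nhds hε)).exists
  refine lt_irrefl ε ((hlt (φ n)).trans (lt_of_le_of_lt ?_ hn))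
  exact infEDist_le_infEDist_add_edist.trans
    (add_le_add_left ((infEdist_le_esemidist hzA _).trans (le_max_right _ _)) _)
end
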